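/- Let n = 2, γ > 0, c_γ = γ^γ/(γ+2)^{γ+2}, and Φ_γ(η) = c_γ F(η)^{2+γ}/(η_1 η_2). If η* with η_1* > 0, η_2* > 0 is a local minimizer of Φ_γ on the positive quadrant and F(η*) > 0, then for i = 1, 2 the partial derivative ∂_iF(η*) exists, i.e., ∂_i⁻F(η*) = ∂_i⁺F(η*). -/

import Mathlib

open Filter Set Topology

/-- The value function `F(η) = inf_{x ∈ Q} (φ(x) + Σ_i η_i ψ_i(x))` of
multi-parameter Tikhonov regularization. -/
noncomputable def valueFun {X : Type*} {n : ℕ} (Q : Set X) (φ : X → ℝ)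
    (ψ : Fin n → X → ℝ) (η : Fin n → ℝ) : ℝ :=
  sInf ((fun x => φ x + ∑ i, η i * ψ i x) '' Q)

/-- `HasDPlus F η i D` says that the right-sided partial derivative
`∂_i⁺F(η) = lim_{h→0⁺} (F(η + h eᵢ) - F(η))/h` exists and equals `D`. -/
def HasDPlus {n : ℕ} (F : (Fin n → ℝ) → ℝ) (η : Fin n → ℝ) (i : Fin n) (D : ℝ) : Prop :=
  Filter.Tendsto (fun h : ℝ => (F (η + h • (Pi.single i 1 : Fin n → ℝ)) - F η) / h)
    (nhdsWithin 0 (Set.Ioi 0)) (nhds D)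

/-- `HasDMinus F η i D` says that the left-sided partial derivative
`∂_i⁻F(η) = lim_{h→0⁺} (F(η) - F(η - h eᵢ))/h` exists and equals `D`. -/
def HasDMinus {n : ℕ} (F : (Fin n → ℝ) → ℝ) (η : Fin n → ℝ) (i : Fin n) (D : ℝ) : Prop :=
  Filter.Tendsto (fun h : ℝ => (F η - F (η - h • (Pi.single i 1 : Fin n → ℝ))) / h)
    (nhdsWithin 0 (Set.Ioi 0)) (nhds D)

section ValueFun

variable {X : Type*} {n : ℕ} {Q : Set X} {φ : X → ℝ} {ψ : Fin n → X → ℝ}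

lemma tikhonov_nonneg (hφ : ∀ x, 0 ≤ φ x) (hψ : ∀ i x, 0 ≤ ψ i x) {η : Fin n → ℝ}
    (hη : ∀ i, 0 ≤ η i) (x : X) : 0 ≤ φ x + ∑ i, η i * ψ i x :=
  add_nonneg (hφ x) (Finset.sum_nonneg fun i _ => mul_nonneg (hη i) (hψ i x))

lemma valueFun_nonneg (hφ : ∀ x, 0 ≤ φ x) (hψ : ∀ i x, 0 ≤ ψ i x) {η : Fin n → ℝ}
    (hη : ∀ i, 0 ≤ η i) : 0 ≤ valueFun Q φ ψ η := by
  apply Real.sInf_nonneg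
  rintro _ ⟨x, -, rfl⟩
  exact tikhonov_nonneg hφ hψ hη x

lemma valueFun_le (hφ : ∀ x, 0 ≤ φ x) (hψ : ∀ i x, 0 ≤ ψ i x) {η : Fin n → ℝ}
    (hη : ∀ i, 0 ≤ η i) {x : X} (hx : x ∈ Q) :
    valueFun Q φ ψ η ≤ φ x + ∑ i, η i * ψ i x := by
  refine csInf_le ⟨0, ?_⟩ (mem_image_of_mem _ hx)
  rintro _ ⟨y, -, rfl⟩
  exact tikhonov_nonneg hφ hψ hη y

/-- Midpoint concavity of the value function. -/
lemma valueFun_add_add_valueFun_sub_le (hQ : Q.Nonempty) (hφ : ∀ x, 0 ≤ φ x)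
    (hψ : ∀ i x, 0 ≤ ψ i x) {η v : Fin n → ℝ} (hadd : ∀ i, 0 ≤ (η + v) i)
    (hsub : ∀ i, 0 ≤ (η - v) i) :
    valueFun Q φ ψ (η + v) + valueFun Q φ ψ (η - v) ≤ 2 * valueFun Q φ ψ η := by
  suffices h : (valueFun Q φ ψ (η + v) + valueFun Q φ ψ (η - v)) / 2 ≤ valueFun Q φ ψ η by
    linarith
  refine le_csInf (hQ.image _) ?_
  rintro _ ⟨x, hx, rfl⟩
  have h₁ := valueFun_le hφ hψ hadd hx
  have h₂ := valueFun_le hφ hψ hsub hx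
  simp only [Pi.add_apply, Pi.sub_apply, add_mul, sub_mul, Finset.sum_add_distrib,
    Finset.sum_sub_distrib] at h₁ h₂
  dsimp only
  linarith

end ValueFun

/-- A function that is midpoint concave at `0` and touches a differentiable minorant there has
equal one-sided derivatives at `0`. -/
lemma tendsto_slopes_of_minorant {f m : ℝ → ℝ} {d : ℝ} (hm : HasDerivAt m d 0)
    (h0 : m 0 = f 0) (hle : ∀ᶠ t in 𝓝 0, m t ≤ f t)
    (hconc : ∀ᶠ t in 𝓝[>] 0, f t + f (-t) ≤ 2 * f 0) :
    Tendsto (fun h => (f 0 - f (-h)) / h) (𝓝[>] 0) (𝓝 d) ∧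
      Tendsto (fun h => (f h - f 0) / h) (𝓝[>] 0) (𝓝 d) := by
  have hlow : Tendsto (fun h => (m h - m 0) / h) (𝓝[>] 0) (𝓝 d) := by
    simpa [div_eq_inv_mul] using hm.tendsto_slope_zero_right
  have hupp : Tendsto (fun h => (m 0 - m (-h)) / h) (𝓝[>] 0) (𝓝 d) := by
    have hneg : HasDerivAt (fun t => -m (-t)) d 0 := by
      have hm' : HasDerivAt m d (-0) := by simpa using hm
      exact (hm'.scomp (0 : ℝ) (hasDerivAt_neg (0 : ℝ))).neg.congr_deriv (by simp)
    refine hneg.tendsto_slope_zero_right.congr fun h => ?_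
    simp only [zero_add, neg_zero, smul_eq_mul, div_eq_inv_mul]
    ring
  have hle_neg : ∀ᶠ t in 𝓝[>] (0 : ℝ), m (-t) ≤ f (-t) := by
    have : Tendsto (fun t : ℝ => -t) (𝓝[>] 0) (𝓝 0) :=
      (continuous_neg.tendsto' 0 0 neg_zero).mono_left nhdsWithin_le_nhds
    exact this.eventually hle
  have hle_pos := hle.filter_mono (nhdsWithin_le_nhds (s := Ioi 0))
  constructor <;> refine tendsto_of_tendsto_of_tendsto_of_le_of_le' hlow hupp ?_ ?_ <;>
    filter_upwards [hle_neg, hle_pos, hconc, self_mem_nhdsWithin] with t h₁ h₂ h₃ (ht : 0 < t) <;>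
    exact div_le_div_of_nonneg_right (by linarith) ht.le

/-- at a local minimizer `η*` (with positive components) of the balancing
criterion `Φ_γ(η) = c_γ F(η)^{2+γ}/(η₁η₂)` with `F(η*) > 0`, the partial derivatives of
the value function exist, i.e. `∂_i⁻F(η*) = ∂_i⁺F(η*)` for `i = 1, 2`. -/
theorem partial_derivatives_exist_at_local_min_of_Phi
    {X : Type*} (Q : Set X) (hQ : Q.Nonempty)
    (φ : X → ℝ) (hφ : ∀ x, 0 ≤ φ x)
    (ψ : Fin 2 → X → ℝ) (hψ : ∀ i x, 0 ≤ ψ i x)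
    (γ : ℝ) (hγ : 0 < γ)
    (ηstar : Fin 2 → ℝ) (hηstar : ∀ i, 0 < ηstar i)
    (hFpos : 0 < valueFun Q φ ψ ηstar)
    (hmin : IsLocalMin
      (fun η : Fin 2 → ℝ =>
        (γ ^ γ / (γ + 2) ^ (γ + 2)) * valueFun Q φ ψ η ^ (2 + γ) / (η 0 * η 1))
      ηstar) :
    ∀ i : Fin 2, ∃ D : ℝ,
      HasDMinus (valueFun Q φ ψ) ηstar i D ∧ HasDPlus (valueFun Q φ ψ) ηstar i D := by
  intro i
  set F := valueFun Q φ ψ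
  set a := ηstar i with ha
  have ha_pos : 0 < a := hηstar i
  have hp : 0 < 2 + γ := by linarith
  let e : ℝ → Fin 2 → ℝ := fun t => ηstar + t • (Pi.single i 1 : Fin 2 → ℝ)
  have he0 : e 0 = ηstar := by simp [e]
  have he_cont : Tendsto e (𝓝 0) (𝓝 ηstar) := by
    have : Continuous e := by fun_prop
    simpa [he0] using this.tendsto 0
  have he_nonneg : ∀ t, -a < t → ∀ j, 0 ≤ e t j := by
    intro t ht j
    rcases eq_or_ne j i with rfl | hj
    · simp only [e, Pi.add_apply, Pi.smul_apply, Pi.single_eq_same, smul_eq_mul]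
      linarith
    · simpa [e, Pi.single_eq_of_ne hj] using (hηstar j).le
  have he_prod : ∀ t, e t 0 * e t 1 = ηstar 0 * ηstar 1 * (1 + t / a) := by
    intro t
    have h₀ := (hηstar 0).ne'
    have h₁ := (hηstar 1).ne'
    fin_cases i <;> simp [e, ha] <;> field_simp
  let m : ℝ → ℝ := fun t => F ηstar * (1 + t / a) ^ (2 + γ)⁻¹
  have hm0 : m 0 = F (e 0) := by simp [m, he0]
  have hm : DifferentiableAt ℝ m 0 := by
    refine DifferentiableAt.const_mul ?_ _
    exact DifferentiableAt.rpow_const (by fun_prop) (Or.inl (by simp))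
  have hle : ∀ᶠ t in 𝓝 0, m t ≤ F (e t) := by
    filter_upwards [he_cont.eventually hmin, Ioi_mem_nhds (neg_lt_zero.mpr ha_pos)] with t ht
      (hta : -a < t)
    have hs : 0 < 1 + t / a := by
      have : 0 < (a + t) / a := div_pos (by linarith) ha_pos
      rwa [add_div, div_self ha_pos.ne'] at this
    have hc : 0 < γ ^ γ / (γ + 2) ^ (γ + 2) := by positivity
    have hη : 0 < ηstar 0 * ηstar 1 := mul_pos (hηstar 0) (hηstar 1)
    have hFt : 0 ≤ F (e t) := valueFun_nonneg hφ hψ (he_nonneg t hta)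
    rw [he_prod, div_le_div_iff₀ hη (mul_pos hη hs)] at ht
    have hpow : F ηstar ^ (2 + γ) * (1 + t / a) ≤ F (e t) ^ (2 + γ) := by
      refine le_of_mul_le_mul_left ?_ (mul_pos hc hη)
      linarith
    refine (Real.rpow_le_rpow_iff (by positivity) hFt hp).mp ?_
    rwa [Real.mul_rpow hFpos.le (by positivity), Real.rpow_inv_rpow hs.le hp.ne']
  have hsub : ∀ t, e (-t) = ηstar - t • (Pi.single i 1 : Fin 2 → ℝ) := by
    intro t
    simp [e, sub_eq_add_neg]
  have hconc : ∀ᶠ t in 𝓝[>] 0, F (e t) + F (e (-t)) ≤ 2 * F (e 0) := by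
    filter_upwards [self_mem_nhdsWithin, nhdsWithin_le_nhds (Iio_mem_nhds ha_pos)] with t
      (ht : 0 < t) (hta : t < a)
    have hminus := he_nonneg (-t) (by linarith)
    rw [hsub] at hminus ⊢
    rw [he0]
    exact valueFun_add_add_valueFun_sub_le hQ hφ hψ (he_nonneg t (by linarith)) hminus
  obtain ⟨hleft, hright⟩ := tendsto_slopes_of_minorant hm.hasDerivAt hm0 hle hconc
  simp only [hsub, he0] at hleft hright
  exact ⟨_, hleft, hright⟩
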